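/- arXiv:2103.14825 — 2 statements merged into one kernel-verified Lean document; each statement's English description precedes it below -/
import Mathlib

section
/- Let R be a Noetherian ring, A an R-module, and B a submodule of A. If every finitely generated submodule of B can be generated by at most s elements, and every finitely generated submodule of A/B can be generated by at most t elements, then every finitely generated submodule of A can be generated by at most s + t elements. -/
/-- A finite set in the image of `N` under `f` lifts to a finite subset of `N` of no larger
cardinality. -/
theorem Finset.exists_lift_card_le {α β : Type*} {f : α → β} {N : Set α} (T : Finset β)
    (h : (T : Set β) ⊆ f '' N) :
    ∃ T' : Finset α, (T' : Set α) ⊆ N ∧ f '' T' = T ∧ T'.card ≤ T.card := by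
  classical
  choose g hgN hg using fun b : T ↦ h b.2
  refine ⟨T.attach.image g, ?_, ?_, Finset.card_image_le.trans T.card_attach.le⟩
  · intro x hx
    obtain ⟨b, -, rfl⟩ := Finset.mem_image.mp hx
    exact hgN b
  · rw [← Finset.coe_image, Finset.image_image, show f ∘ g = Subtype.val from funext hg,
      Finset.attach_image_val]

/-- Over a Noetherian ring, the part of a finitely generated submodule lying in `B` is finitely
generated. -/
theorem Submodule.FG.comap_subtype {R A : Type*} [Ring R] [IsNoetherianRing R] [AddCommGroup A]
    [Module R A] {N : Submodule R A} (hN : N.FG) (B : Submodule R A) :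
    (N.comap B.subtype).FG := by
  have : IsNoetherian R N := isNoetherian_of_fg_of_noetherian N hN
  refine Submodule.fg_of_fg_map_injective B.subtype B.subtype_injective ?_
  have : IsNoetherian R ((N.comap B.subtype).map B.subtype) :=
    isNoetherian_of_le (Submodule.map_comap_le _ N)
  exact Module.Finite.iff_fg.mp inferInstance

/-- A submodule `K ≤ N` containing `N ⊓ B` with the same image as `N` modulo `B` equals `N`. -/
theorem Submodule.eq_of_le_of_inf_le_of_map_mkQ_le {R A : Type*} [Ring R] [AddCommGroup A]
    [Module R A] {B K N : Submodule R A} (hKN : K ≤ N) (hB : N ⊓ B ≤ K)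
    (hQ : N.map B.mkQ ≤ K.map B.mkQ) : K = N := by
  refine le_antisymm hKN fun x hx ↦ ?_
  obtain ⟨y, hy, hyx⟩ := hQ (Submodule.mem_map_of_mem hx)
  have hxy : x - y ∈ B := (Submodule.Quotient.eq B).mp hyx.symm
  simpa using K.add_mem (hB ⟨N.sub_mem hx (hKN hy), hxy⟩) hy

/-- Over a Noetherian ring, if every finitely generated submodule of `B` needs at
most `s` generators and every finitely generated submodule of `A ⧸ B` needs at most `t`
generators, then every finitely generated submodule of `A` needs at most `s + t` generators. -/
theorem stmt2 (R : Type*) [Ring R] [IsNoetherianRing R]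
    (A : Type*) [AddCommGroup A] [Module R A] (B : Submodule R A) (s t : ℕ)
    (hB : ∀ N : Submodule R B, N.FG →
      ∃ S : Finset B, S.card ≤ s ∧ Submodule.span R (S : Set B) = N)
    (hQ : ∀ N : Submodule R (A ⧸ B), N.FG →
      ∃ S : Finset (A ⧸ B), S.card ≤ t ∧ Submodule.span R (S : Set (A ⧸ B)) = N) :
    ∀ N : Submodule R A, N.FG →
      ∃ S : Finset A, S.card ≤ s + t ∧ Submodule.span R (S : Set A) = N := by
  classical
  intro N hN
  obtain ⟨S, hSs, hS⟩ := hB _ (hN.comap_subtype B)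
  obtain ⟨T, hTt, hT⟩ := hQ _ (hN.map B.mkQ)
  obtain ⟨T', hT'N, hT'T, hT'⟩ := T.exists_lift_card_le (f := B.mkQ) (N := (N : Set A)) <| by
    rw [← Submodule.map_coe, ← hT]
    exact Submodule.subset_span
  have hS' : Submodule.span R (B.subtype '' S) = N ⊓ B := by
    rw [Submodule.span_image, hS, Submodule.map_comap_subtype, inf_comm]
  refine ⟨S.image B.subtype ∪ T', ?_, ?_⟩
  · have h₁ := Finset.card_union_le (S.image B.subtype) T'
    have h₂ : (S.image B.subtype).card ≤ S.card := Finset.card_image_le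
    lia
  · rw [Finset.coe_union, Finset.coe_image, Submodule.span_union, hS']
    refine Submodule.eq_of_le_of_inf_le_of_map_mkQ_le (B := B)
      (sup_le inf_le_left (Submodule.span_le.mpr hT'N)) le_sup_left ?_
    rw [← hT, ← hT'T, Submodule.span_image]
    exact Submodule.map_mono le_sup_right
end

section
/- Let D be a Dedekind domain, G a finite group, P a maximal ideal of D with char(D/P) = 0, and A a DG-module which is a P-module of finite special rank. Then A = K ⊕ B as DG-modules, where K is finitely generated as a D-module and B is a direct sum of finitely many Prüfer P-modules. -/
/-- `M` is a Prüfer `P`-module: a `P`-module whose submodules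
`Ω_{[P,k]}(M) = torsionBySet D M (P^k)` are isomorphic to `D ⧸ Pᵏ` and are all proper. -/
def IsPruferPModule (D : Type*) [CommRing D] (P : Ideal D)
    (M : Type*) [AddCommGroup M] [Module D M] : Prop :=
  (∀ a : M, ∃ k : ℕ, ∀ x ∈ P ^ k, x • a = 0) ∧
  (∀ k : ℕ, Nonempty ((Submodule.torsionBySet D M ↑(P ^ k)) ≃ₗ[D] D ⧸ (P ^ k))) ∧
  (∀ k : ℕ, Submodule.torsionBySet D M ↑(P ^ k) ≠ ⊤)

section PowerLemmas

variable {D : Type*} [CommRing D] {P : Ideal D} [P.IsMaximal] {π : D}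
  {A : Type*} [AddCommGroup A] [Module D A]

theorem exists_smul_smul_eq (hP : ∀ a : A, ∃ n : ℕ, ∀ x ∈ P ^ n, x • a = 0) {c : D}
    (hc : c ∉ P) (a : A) : ∃ y : D, y • c • a = a := by
  obtain ⟨n, hn⟩ := hP a
  have hcop : IsCoprime (Ideal.span {c}) (P ^ n) := by
    obtain ⟨y, i, hi, hy⟩ := Ideal.IsMaximal.exists_inv ‹P.IsMaximal› hc
    exact IsCoprime.pow_right (Ideal.isCoprime_iff_exists.2
      ⟨y * c, Ideal.mem_span_singleton'.2 ⟨y, rfl⟩, i, hi, hy⟩)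
  obtain ⟨u, hu, v, hv, huv⟩ := Ideal.isCoprime_iff_exists.1 hcop
  obtain ⟨y, rfl⟩ := Ideal.mem_span_singleton'.1 hu
  refine ⟨y, ?_⟩
  conv_rhs => rw [← one_smul D a, ← huv, add_smul, hn v hv, add_zero, mul_smul]

variable [IsDedekindDomain D]

theorem exists_uniformizer (hP : P ≠ ⊥) : ∃ π ∈ P, π ∉ P ^ 2 := by
  have h := Ideal.pow_succ_lt_pow hP 1
  simpa using SetLike.exists_of_lt h

theorem exists_eq_pow_mul_add (hπ : π ∈ P) (hπ' : π ∉ P ^ 2) {j : ℕ} {x : D} (hx : x ∈ P ^ j)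
    (n : ℕ) : ∃ d, ∃ e ∈ P ^ n, x = π ^ j * d + e := by
  have hP : P ≠ ⊥ := by
    rintro rfl
    exact hπ' (by rw [Ideal.mem_bot] at hπ; simp [hπ])
  have hsup : P ≤ Ideal.span {π} ⊔ P ^ 2 := by
    have hle : Ideal.span {π} ⊔ P ^ 2 ≤ P :=
      sup_le ((Ideal.span_singleton_le_iff_mem _).2 hπ) (Ideal.pow_le_self two_ne_zero)
    have hprime : Prime P := Ideal.prime_of_isPrime hP inferInstance
    have hdvd : Ideal.span {π} ⊔ P ^ 2 ∣ P ^ 2 := Ideal.dvd_iff_le.2 le_sup_right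
    obtain ⟨i, hi, h⟩ := (dvd_prime_pow hprime _).1 hdvd
    rw [associated_iff_eq] at h
    interval_cases i
    · rw [h, pow_zero, Ideal.one_eq_top]; exact le_top
    · rw [h, pow_one]
    · exact absurd (h ▸ Ideal.mem_sup_left (Ideal.mem_span_singleton_self π)) hπ'
  have step : ∀ j, P ^ j ≤ Ideal.span {π ^ j} ⊔ P ^ (j + 1) := by
    intro j
    induction j with
    | zero => simp
    | succ j ih =>
      calc P ^ (j + 1) = P ^ j * P := pow_succ _ _
        _ ≤ (Ideal.span {π ^ j} ⊔ P ^ (j + 1)) * P := Ideal.mul_mono_left ih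
        _ = Ideal.span {π ^ j} * P ⊔ P ^ (j + 2) := by rw [Ideal.sup_mul, ← pow_succ]
        _ ≤ Ideal.span {π ^ j} * (Ideal.span {π} ⊔ P ^ 2) ⊔ P ^ (j + 2) :=
          sup_le_sup_right (Ideal.mul_mono_right hsup) _
        _ ≤ Ideal.span {π ^ (j + 1)} ⊔ P ^ (j + 1 + 1) := by
          rw [Ideal.mul_sup, Ideal.span_singleton_mul_span_singleton, ← pow_succ]
          refine sup_le (sup_le le_sup_left (le_sup_of_le_right ?_)) le_sup_right
          rw [show j + 1 + 1 = j + 2 from rfl, pow_add P j 2]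
          exact Ideal.mul_mono_left
            ((Ideal.span_singleton_le_iff_mem _).2 (Ideal.pow_mem_pow hπ j))
  have key : P ^ j ≤ Ideal.span {π ^ j} ⊔ P ^ n := by
    rcases le_total n j with hnj | hjn
    · exact le_sup_of_le_right (Ideal.pow_le_pow_right hnj)
    · induction n, hjn using Nat.le_induction with
      | base => exact le_sup_right
      | succ n hjn ih =>
        refine ih.trans (sup_le le_sup_left ((step n).trans (sup_le_sup_right ?_ _)))
        exact Ideal.span_singleton_le_span_singleton.2 (pow_dvd_pow π hjn)
  obtain ⟨y, hy, e, he, rfl⟩ := Submodule.mem_sup.1 (key hx)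
  obtain ⟨d, rfl⟩ := Ideal.mem_span_singleton'.1 hy
  exact ⟨d, e, he, by ring⟩

theorem exists_smul_eq_smul_pow_smul (hP : ∀ a : A, ∃ n : ℕ, ∀ x ∈ P ^ n, x • a = 0)
    (hπ : π ∈ P) (hπ' : π ∉ P ^ 2) {j : ℕ} {x : D} (hx : x ∈ P ^ j) (a : A) :
    ∃ d : D, x • a = d • π ^ j • a := by
  obtain ⟨n, hn⟩ := hP a
  obtain ⟨d, e, he, rfl⟩ := exists_eq_pow_mul_add hπ hπ' hx n
  exact ⟨d, by rw [add_smul, hn e he, add_zero, smul_smul, mul_comm]⟩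

/-- Divisible submodules of a `P`-module are direct summands. -/
theorem exists_isCompl_of_divisible (hP : ∀ a : A, ∃ n : ℕ, ∀ x ∈ P ^ n, x • a = 0)
    (hπ : π ∈ P) (hπ' : π ∉ P ^ 2) (B : Submodule D A) (hB : ∀ b ∈ B, ∃ c ∈ B, π • c = b) :
    ∃ K, IsCompl B K := by
  obtain ⟨K, hK⟩ : ∃ K, Maximal (fun K : Submodule D A ↦ Disjoint B K) K := by
    refine (zorn_le_nonempty₀ {K : Submodule D A | Disjoint B K} ?_ ⊥ disjoint_bot_right).imp
      fun K h ↦ h.2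
    intro c hc hchain y hy
    refine ⟨sSup c, ?_, fun z hz ↦ le_sSup hz⟩
    have hdir : DirectedOn (· ≤ ·) c := hchain.directedOn
    exact hdir.disjoint_sSup_right.2 fun b hb ↦ hc hb
  have step : ∀ a : A, π • a ∈ B ⊔ K → a ∈ B ⊔ K := by
    intro a ha
    obtain ⟨b, hb, k, hk, hbk⟩ := Submodule.mem_sup.1 ha
    obtain ⟨b', hb', rfl⟩ := hB b hb
    suffices h : a - b' ∈ B ⊔ K by
      simpa using add_mem h (Submodule.mem_sup_left hb')
    have hπK : π • (a - b') ∈ K := by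
      rw [smul_sub, ← hbk, add_sub_cancel_left]; exact hk
    generalize a - b' = a₀ at hπK
    by_contra hnot
    have hlt : ¬ Disjoint B (K ⊔ D ∙ a₀) := fun hdis ↦ by
      have := hK.le_of_ge hdis le_sup_left
      exact hnot (Submodule.mem_sup_right
        (this (Submodule.mem_sup_right (Submodule.mem_span_singleton_self a₀))))
    apply hlt
    rw [Submodule.disjoint_def]
    intro b hb hb2
    obtain ⟨k, hk, z, hz, hkz⟩ := Submodule.mem_sup.1 hb2
    obtain ⟨x, rfl⟩ := Submodule.mem_span_singleton.1 hz
    by_cases hx : x ∈ P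
    · obtain ⟨d, hd⟩ := exists_smul_eq_smul_pow_smul hP hπ hπ' (j := 1) (by simpa using hx) a₀
      rw [pow_one] at hd
      refine Submodule.disjoint_def.1 hK.prop b hb ?_
      rw [← hkz, hd]
      exact add_mem hk (K.smul_mem _ hπK)
    · obtain ⟨y, hy⟩ := exists_smul_smul_eq hP hx a₀
      refine absurd ?_ hnot
      rw [← hy]
      refine Submodule.smul_mem _ _ ?_
      rw [← add_sub_cancel_left k (x • a₀), hkz]
      exact sub_mem (Submodule.mem_sup_left hb) (Submodule.mem_sup_right hk)
  refine ⟨K, hK.prop, codisjoint_iff.2 (eq_top_iff.2 fun a _ ↦ ?_)⟩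
  obtain ⟨n, hn⟩ := hP a
  have h0 : π ^ n • a ∈ B ⊔ K := by rw [hn _ (Ideal.pow_mem_pow hπ n)]; exact zero_mem _
  clear hn
  induction n with
  | zero => simpa using h0
  | succ n ih => exact ih (step _ (by rwa [smul_smul, ← pow_succ']))

end PowerLemmas

section Chains

variable {D : Type*} [CommRing D] {P : Ideal D} {π : D} {A : Type*} [AddCommGroup A] [Module D A]

theorem pow_smul_chain {e : ℕ → A} (he : ∀ n, π • e (n + 1) = e n) (j n : ℕ) :
    π ^ j • e (n + j) = e n := by
  induction j with
  | zero => simp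
  | succ j ih => rw [pow_succ, mul_smul, ← add_assoc, he, ih]

theorem exists_smul_chain {e : ℕ → A} (he : ∀ n, π • e (n + 1) = e n) {a : A}
    (ha : a ∈ Submodule.span D (Set.range e)) : ∃ N, ∀ n ≥ N, ∃ x : D, x • e n = a := by
  induction ha using Submodule.span_induction with
  | mem a h =>
    obtain ⟨N, rfl⟩ := h
    refine ⟨N, fun n hn ↦ ⟨π ^ (n - N), ?_⟩⟩
    obtain ⟨k, rfl⟩ := Nat.exists_eq_add_of_le hn
    rw [Nat.add_sub_cancel_left, pow_smul_chain he]
  | zero => exact ⟨0, fun n _ ↦ ⟨0, zero_smul _ _⟩⟩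
  | add a b _ _ iha ihb =>
    obtain ⟨N, hN⟩ := iha
    obtain ⟨M, hM⟩ := ihb
    refine ⟨max N M, fun n hn ↦ ?_⟩
    obtain ⟨x, hx⟩ := hN n (le_of_max_le_left hn)
    obtain ⟨y, hy⟩ := hM n (le_of_max_le_right hn)
    exact ⟨x + y, by rw [add_smul, hx, hy]⟩
  | smul c a _ iha =>
    obtain ⟨N, hN⟩ := iha
    refine ⟨N, fun n hn ↦ ?_⟩
    obtain ⟨x, hx⟩ := hN n hn
    exact ⟨c * x, by rw [mul_smul, hx]⟩

variable [IsDedekindDomain D] [P.IsMaximal]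

theorem smul_chain_eq_zero (hP : ∀ a : A, ∃ n : ℕ, ∀ x ∈ P ^ n, x • a = 0) (hπ : π ∈ P)
    (hπ' : π ∉ P ^ 2) {e : ℕ → A} (he0 : e 0 = 0) (he : ∀ n, π • e (n + 1) = e n)
    {n : ℕ} {x : D} (hx : x ∈ P ^ n) : x • e n = 0 := by
  obtain ⟨d, hd⟩ := exists_smul_eq_smul_pow_smul hP hπ hπ' hx (e n)
  have := pow_smul_chain he n 0
  rw [zero_add] at this
  rw [hd, this, he0, smul_zero]

theorem mem_pow_of_sum_smul_chain_eq_zero (hP : ∀ a : A, ∃ n : ℕ, ∀ x ∈ P ^ n, x • a = 0)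
    (hπ : π ∈ P) (hπ' : π ∉ P ^ 2) {ι : Type*} [Fintype ι] {e : ι → ℕ → A}
    (he0 : ∀ i, e i 0 = 0) (he : ∀ i n, π • e i (n + 1) = e i n)
    (hind : ∀ c : ι → D, ∑ i, c i • e i 1 = 0 → ∀ i, c i ∈ P) (n : ℕ) (x : ι → D)
    (hx : ∑ i, x i • e i n = 0) (i : ι) : x i ∈ P ^ n := by
  induction n generalizing i with
  | zero => simp
  | succ n ih =>
    have hxn : ∀ i, x i ∈ P ^ n := by
      apply ih
      have := congrArg (π • ·) hx
      simpa [Finset.smul_sum, smul_comm π, he] using this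
    choose d r hr hd using fun i ↦ exists_eq_pow_mul_add hπ hπ' (hxn i) (n + 1)
    have h1 : ∀ i, x i • e i (n + 1) = d i • e i 1 := by
      intro i
      have := pow_smul_chain (he i) n 1
      rw [add_comm] at this
      rw [hd i, add_smul, smul_chain_eq_zero hP hπ hπ' (he0 i) (he i) (hr i), add_zero,
        mul_comm, mul_smul, this]
    have hdP : ∀ i, d i ∈ P := hind d (by simpa only [h1] using hx)
    rw [hd i]
    exact add_mem (by rw [pow_succ]; exact Ideal.mul_mem_mul (Ideal.pow_mem_pow hπ n) (hdP i))
      (hr i)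

theorem isPruferPModule_span_chain (hP : ∀ a : A, ∃ n : ℕ, ∀ x ∈ P ^ n, x • a = 0)
    (hπ : π ∈ P) (hπ' : π ∉ P ^ 2) {e : ℕ → A}
    (he0 : e 0 = 0) (he : ∀ n, π • e (n + 1) = e n) (hind : ∀ c : D, c • e 1 = 0 → c ∈ P) :
    IsPruferPModule D P (Submodule.span D (Set.range e)) := by
  have hann : ∀ (n : ℕ) (x : D), x • e n = 0 → x ∈ P ^ n := fun n x hx ↦
    mem_pow_of_sum_smul_chain_eq_zero hP hπ hπ' (ι := Unit) (e := fun _ ↦ e) (fun _ ↦ he0)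
      (fun _ ↦ he) (fun c hc _ ↦ hind _ (by simpa using hc)) n (fun _ ↦ x) (by simpa using hx) ()
  have hzero : ∀ (n : ℕ) (x : D), x ∈ P ^ n → x • e n = 0 := fun n x hx ↦
    smul_chain_eq_zero hP hπ hπ' he0 he hx
  have hmem : ∀ n, e n ∈ Submodule.span D (Set.range e) := fun n ↦
    Submodule.subset_span ⟨n, rfl⟩
  refine ⟨fun a ↦ ?_, fun k ↦ ?_, fun k htop ↦ ?_⟩
  · obtain ⟨n, hn⟩ := hP a
    exact ⟨n, fun x hx ↦ Subtype.ext (hn x hx)⟩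
  · let f := LinearMap.toSpanSingleton D (Submodule.span D (Set.range e)) ⟨e k, hmem k⟩
    have hker : LinearMap.ker f = P ^ k := by
      ext x
      rw [LinearMap.mem_ker, LinearMap.toSpanSingleton_apply, Subtype.ext_iff]
      exact ⟨hann k x, hzero k x⟩
    have hrange : LinearMap.range f = Submodule.torsionBySet D _ ↑(P ^ k) := by
      ext ⟨a, ha⟩
      rw [Submodule.mem_torsionBySet_iff]
      constructor
      · rintro ⟨y, hy⟩ ⟨x, hx⟩
        have hy' : y • e k = a := congrArg Subtype.val hy
        apply Subtype.ext
        change x • a = 0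
        rw [← hy', smul_comm, hzero k x hx, smul_zero]
      · intro h
        obtain ⟨N, hN⟩ := exists_smul_chain he ha
        obtain ⟨x, rfl⟩ := hN (N + k) (Nat.le_add_right _ _)
        have h0 : π ^ k • x • e (N + k) = 0 :=
          congrArg Subtype.val (h ⟨π ^ k, Ideal.pow_mem_pow hπ k⟩)
        rw [smul_comm, pow_smul_chain he] at h0
        obtain ⟨d, hd⟩ := exists_smul_eq_smul_pow_smul hP hπ hπ' (hann N x h0) (e (N + k))
        refine ⟨d, Subtype.ext ?_⟩
        change d • e k = x • e (N + k)
        rw [hd, add_comm, pow_smul_chain he]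
    exact ⟨((Submodule.quotEquivOfEq _ _ hker.symm).trans
      (f.quotKerEquivRange.trans (LinearEquiv.ofEq _ _ hrange))).symm⟩
  · have h : (⟨e (k + 1), hmem _⟩ : Submodule.span D (Set.range e)) ∈
        Submodule.torsionBySet D _ ↑(P ^ k) := htop ▸ Submodule.mem_top
    rw [Submodule.mem_torsionBySet_iff] at h
    have h0 : π ^ k • e (k + 1) = 0 :=
      congrArg Subtype.val (h ⟨π ^ k, Ideal.pow_mem_pow hπ k⟩)
    have h1 := pow_smul_chain he k 1
    rw [add_comm, h0] at h1
    exact Ideal.IsMaximal.ne_top ‹P.IsMaximal› ((Ideal.eq_top_iff_one _).2 (hind 1 (by simp [← h1])))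

theorem iSupIndep_span_chain (hP : ∀ a : A, ∃ n : ℕ, ∀ x ∈ P ^ n, x • a = 0)
    (hπ : π ∈ P) (hπ' : π ∉ P ^ 2) {ι : Type*} [Fintype ι] {e : ι → ℕ → A}
    (he0 : ∀ i, e i 0 = 0) (he : ∀ i n, π • e i (n + 1) = e i n)
    (hind : ∀ c : ι → D, ∑ i, c i • e i 1 = 0 → ∀ i, c i ∈ P) :
    iSupIndep fun i ↦ Submodule.span D (Set.range (e i)) := by
  classical
  apply iSupIndep_of_dfinsupp_lsum_injective
  rw [← LinearMap.ker_eq_bot, LinearMap.ker_eq_bot']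
  intro f hf
  have hsum : ∑ i, (f i : A) = 0 := by
    rw [DFinsupp.lsum_apply_apply, DFinsupp.sumAddHom_apply,
      DFinsupp.sum_eq_sum_fintype _ (by simp)] at hf
    simpa using hf
  choose N hN using fun i ↦ exists_smul_chain (he i) (f i).2
  choose x hx using fun i ↦ hN i (Finset.univ.sup N) (Finset.le_sup (Finset.mem_univ i))
  have hxP := mem_pow_of_sum_smul_chain_eq_zero hP hπ hπ' he0 he hind (Finset.univ.sup N) x
    (by simpa only [hx] using hsum)
  ext i
  rw [← hx i, smul_chain_eq_zero hP hπ hπ' (he0 i) (he i) (hxP i)]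
  simp

end Chains

section Divisible

variable {D : Type*} [CommRing D] {P : Ideal D} [P.IsMaximal] {π : D}

theorem exists_basis_of_isTorsionBySet {M : Type*} [AddCommGroup M] [Module D M]
    [Module.Finite D M] (hM : Module.IsTorsionBySet D M P) :
    ∃ (m : ℕ) (v : Fin m → M), Submodule.span D (Set.range v) = ⊤ ∧
      ∀ c : Fin m → D, ∑ i, c i • v i = 0 → ∀ i, c i ∈ P := by
  let : Field (D ⧸ P) := Ideal.Quotient.field P
  let : Module (D ⧸ P) M := hM.module
  have : IsScalarTower D (D ⧸ P) M := hM.isScalarTower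
  have : Module.Finite (D ⧸ P) M := Module.Finite.of_restrictScalars_finite D _ _
  let b := Module.finBasis (D ⧸ P) M
  refine ⟨_, b, ?_, fun c hc i ↦ ?_⟩
  · rw [← Submodule.restrictScalars_span D (D ⧸ P) Ideal.Quotient.mk_surjective, b.span_eq,
      Submodule.restrictScalars_top]
  · have h := Fintype.linearIndependent_iff.1 b.linearIndependent
      (fun i ↦ Ideal.Quotient.mk P (c i)) hc i
    exact Ideal.Quotient.eq_zero_iff_mem.1 h

theorem isArtinian_of_isTorsionBySet {M : Type*} [AddCommGroup M] [Module D M]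
    [Module.Finite D M] (hM : Module.IsTorsionBySet D M P) : IsArtinian D M := by
  let : Field (D ⧸ P) := Ideal.Quotient.field P
  let : Module (D ⧸ P) M := hM.module
  have : IsScalarTower D (D ⧸ P) M := hM.isScalarTower
  have : Module.Finite (D ⧸ P) M := Module.Finite.of_restrictScalars_finite D _ _
  exact isArtinian_of_surjective_algebraMap (R := D ⧸ P) Ideal.Quotient.mk_surjective

variable [IsDedekindDomain D] {A : Type*} [AddCommGroup A] [Module D A]

theorem torsionBySet_eq_torsionBy (hP : ∀ a : A, ∃ n : ℕ, ∀ x ∈ P ^ n, x • a = 0)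
    (hπ : π ∈ P) (hπ' : π ∉ P ^ 2) :
    Submodule.torsionBySet D A P = Submodule.torsionBy D A π := by
  ext a
  rw [Submodule.mem_torsionBySet_iff, Submodule.mem_torsionBy_iff]
  refine ⟨fun h ↦ h ⟨π, hπ⟩, fun h ⟨x, hx⟩ ↦ ?_⟩
  obtain ⟨d, hd⟩ := exists_smul_eq_smul_pow_smul hP hπ hπ' (j := 1) (by simpa using hx) a
  rw [pow_one, h, smul_zero] at hd
  exact hd

theorem torsionBy_pow_fg {S : Type*} [CommRing S] [IsNoetherianRing S] [Module S A] {s : S}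
    (h : (Submodule.torsionBy S A s).FG) (n : ℕ) : (Submodule.torsionBy S A (s ^ n)).FG := by
  induction n with
  | zero =>
    convert Submodule.fg_bot (R := S) (M := A)
    simp
  | succ n ih =>
    have := isNoetherian_of_fg_of_noetherian _ h
    have := isNoetherian_of_fg_of_noetherian _ ih
    refine Submodule.fg_of_fg_map_of_fg_inf_ker (s • (LinearMap.id : A →ₗ[S] A)) ?_ ?_
    · refine Submodule.FG.of_le ih ?_
      rintro _ ⟨a, ha, rfl⟩
      have ha' : s ^ (n + 1) • a = 0 := ha
      rw [Submodule.mem_torsionBy_iff]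
      simpa [smul_smul, ← pow_succ] using ha'
    · exact Submodule.FG.of_le h inf_le_right

/-- A divisible `P`-module with finitely generated socle is a finite direct sum of Prüfer
`P`-modules. -/
theorem exists_pruferPModule_decomposition
    (hP : ∀ a : A, ∃ n : ℕ, ∀ x ∈ P ^ n, x • a = 0) (hπ : π ∈ P) (hπ' : π ∉ P ^ 2)
    (hfg : (Submodule.torsionBy D A π).FG) (B : Submodule D A)
    (hB : ∀ b ∈ B, ∃ c ∈ B, π • c = b) :
    ∃ (m : ℕ) (C : Fin m → Submodule D A), iSupIndep C ∧ (⨆ i, C i) = B ∧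
      ∀ i, IsPruferPModule D P (C i) := by
  let T : Submodule D A := B ⊓ Submodule.torsionBy D A π
  have : Module.Finite D T := Module.Finite.iff_fg.2 (hfg.of_le inf_le_right)
  have hT : Module.IsTorsionBySet D T P := by
    rintro ⟨a, ha⟩ x
    have ha2 : a ∈ Submodule.torsionBy D A π := ha.2
    rw [← torsionBySet_eq_torsionBy hP hπ hπ', Submodule.mem_torsionBySet_iff] at ha2
    exact Subtype.ext (ha2 x)
  obtain ⟨m, v, hspan, hind⟩ := exists_basis_of_isTorsionBySet hT
  choose d hdB hd using hB
  let g : B → B := fun b ↦ ⟨d b b.2, hdB b b.2⟩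
  have hg : ∀ b : B, π • (g b : A) = b := fun b ↦ hd b b.2
  let e : Fin m → ℕ → A := fun i n ↦
    n.casesOn 0 fun k ↦ (g^[k] ⟨v i, (v i).2.1⟩ : B)
  have he0 : ∀ i, e i 0 = 0 := fun i ↦ rfl
  have he1 : ∀ i, e i 1 = v i := fun i ↦ rfl
  have he : ∀ i n, π • e i (n + 1) = e i n := by
    rintro i (_ | n)
    · exact (v i).2.2
    · change π • ((g^[n + 1] _ : B) : A) = (g^[n] _ : B)
      rw [Function.iterate_succ_apply', hg]
  have heB : ∀ i n, e i n ∈ B := by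
    rintro i (_ | n)
    · exact zero_mem _
    · exact (g^[n] _ : B).2
  have hinde : ∀ c : Fin m → D, ∑ i, c i • e i 1 = 0 → ∀ i, c i ∈ P := by
    intro c hc
    refine hind c (Subtype.ext ?_)
    simpa [he1] using hc
  refine ⟨m, fun i ↦ Submodule.span D (Set.range (e i)),
    iSupIndep_span_chain hP hπ hπ' he0 he hinde, le_antisymm ?_ ?_, fun i ↦ ?_⟩
  · refine iSup_le fun i ↦ Submodule.span_le.2 ?_
    rintro _ ⟨n, rfl⟩
    exact heB i n
  · set C : Submodule D A := ⨆ i, Submodule.span D (Set.range (e i)) with hC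
    have heC : ∀ i n, e i n ∈ C := fun i n ↦
      Submodule.mem_iSup_of_mem i (Submodule.subset_span ⟨n, rfl⟩)
    have hCB : C ≤ B := by
      refine iSup_le fun i ↦ Submodule.span_le.2 ?_
      rintro _ ⟨n, rfl⟩
      exact heB i n
    have hTC : T ≤ C := by
      rw [← Submodule.map_subtype_top T, ← hspan, Submodule.map_span, Submodule.span_le]
      rintro _ ⟨_, ⟨i, rfl⟩, rfl⟩
      exact heC i 1
    have hdiv : C ≤ C.map (π • (LinearMap.id : A →ₗ[D] A)) := by
      refine iSup_le fun i ↦ Submodule.span_le.2 ?_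
      rintro _ ⟨n, rfl⟩
      exact ⟨e i (n + 1), heC i (n + 1), he i n⟩
    have key : ∀ n, ∀ b ∈ B, π ^ n • b = 0 → b ∈ C := by
      intro n
      induction n with
      | zero => intro b _ h; rw [pow_zero, one_smul] at h; rw [h]; exact zero_mem _
      | succ n ih =>
        intro b hb h
        obtain ⟨c, hc, hcb⟩ := hdiv (ih (π • b) (B.smul_mem _ hb) (by rwa [smul_smul, ← pow_succ]))
        have hcb' : π • c = π • b := hcb
        have : b - c ∈ T :=
          ⟨sub_mem hb (hCB hc), by
            change π • (b - c) = 0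
            rw [smul_sub, hcb', sub_self]⟩
        simpa using add_mem (hTC this) hc
    intro b hb
    obtain ⟨n, hn⟩ := hP b
    exact key n b hb (hn _ (Ideal.pow_mem_pow hπ n))
  · refine isPruferPModule_span_chain hP hπ hπ' (he0 i) (he i) fun c hc ↦ ?_
    have := hinde (Pi.single i c) ?_ i
    · simpa using this
    · rw [Finset.sum_eq_single i]
      · simpa using hc
      · intro j _ hj
        rw [Pi.single_eq_of_ne hj, zero_smul]
      · simp

/-- In a `P`-module with finitely generated socle, the images of the powers of `π` stabilize. -/
theorem exists_pow_smul_eq_pow_smul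
    (hP : ∀ a : A, ∃ n : ℕ, ∀ x ∈ P ^ n, x • a = 0) (hπ : π ∈ P) (hπ' : π ∉ P ^ 2)
    (hfg : (Submodule.torsionBy D A π).FG) :
    ∃ N : ℕ, ∀ a : A, ∀ m ≥ N, ∃ c : A, π ^ N • a = π ^ m • c := by
  have : Module.Finite D (Submodule.torsionBy D A π) := Module.Finite.iff_fg.2 hfg
  have : IsArtinian D (Submodule.torsionBy D A π) := by
    rw [← torsionBySet_eq_torsionBy hP hπ hπ'] at *
    exact isArtinian_of_isTorsionBySet (Submodule.torsionBySet_isTorsionBySet _)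
  let F : ℕ →o (Submodule D (Submodule.torsionBy D A π))ᵒᵈ :=
    { toFun := fun n ↦ OrderDual.toDual ((LinearMap.range
        (π ^ n • (LinearMap.id : A →ₗ[D] A))).comap (Submodule.subtype _))
      monotone' := by
        intro n m hnm
        rw [OrderDual.toDual_le_toDual]
        rintro x ⟨a, ha⟩
        refine ⟨π ^ (m - n) • a, ?_⟩
        have ha' : π ^ m • a = x := ha
        change π ^ n • π ^ (m - n) • a = x
        rw [smul_smul, ← pow_add, Nat.add_sub_cancel' hnm, ha'] }
  obtain ⟨N, hN⟩ := IsArtinian.monotone_stabilizes F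
  have hsoc : ∀ x : A, π • x = 0 → (∃ a, π ^ N • a = x) → ∀ m ≥ N, ∃ c, π ^ m • c = x := by
    intro x hx ha m hm
    have h1 : (⟨x, hx⟩ : Submodule.torsionBy D A π) ∈ OrderDual.ofDual (F N) := ha
    rw [hN m hm] at h1
    exact h1
  refine ⟨N, ?_⟩
  have key : ∀ j, ∀ x : A, (∃ a, π ^ N • a = x) → π ^ j • x = 0 → ∀ m ≥ N,
      ∃ c, x = π ^ m • c := by
    intro j
    induction j with
    | zero => intro x _ h m _; exact ⟨0, by simpa using h⟩
    | succ j ih =>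
      rintro x ⟨a, rfl⟩ h m hm
      obtain ⟨y, hy⟩ := ih (π • π ^ N • a) ⟨π • a, smul_comm _ _ _⟩
        (by rwa [smul_smul, ← pow_succ]) (m + 1) (by omega)
      obtain ⟨z, hz⟩ := hsoc (π ^ N • a - π ^ m • y)
        (by rw [smul_sub, hy, smul_smul π, ← pow_succ', sub_self])
        ⟨a - π ^ (m - N) • y, by
          rw [smul_sub, smul_smul, ← pow_add, Nat.add_sub_cancel' hm]⟩ m hm
      exact ⟨z + y, by rw [smul_add, hz, sub_add_cancel]⟩
  intro a
  obtain ⟨j, hj⟩ := hP (π ^ N • a)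
  exact key j _ ⟨a, rfl⟩ (hj _ (Ideal.pow_mem_pow hπ j))

end Divisible

section MonoidAlgebraModules

variable {D : Type*} [CommRing D] {G : Type*} [Group G] [Finite G]
  {A : Type*} [AddCommGroup A] [Module (MonoidAlgebra D G) A] [Module D A]
  [IsScalarTower D (MonoidAlgebra D G) A]

open scoped Pointwise in
theorem torsionBySet_fg_of_finite_special_rank (P : Ideal D) [P.IsMaximal] {r : ℕ}
    (hr : ∀ N : Submodule (MonoidAlgebra D G) A, N.FG →
      ∃ S : Finset A, S.card ≤ r ∧ Submodule.span (MonoidAlgebra D G) (S : Set A) = N) :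
    (Submodule.torsionBySet D A P).FG := by
  classical
  have := Fintype.ofFinite G
  let : Field (D ⧸ P) := Ideal.Quotient.field P
  have : SMulCommClass D (MonoidAlgebra D G) A := IsScalarTower.to_smulCommClass
  let V := Submodule.torsionBySet D A P
  have hVG : ∀ (x : MonoidAlgebra D G) (a : A), a ∈ V → x • a ∈ V := by
    intro x a ha
    rw [Submodule.mem_torsionBySet_iff] at ha ⊢
    intro p
    rw [Subtype.forall] at ha
    rw [smul_comm, ha p p.2, smul_zero]
  have hrank : Module.rank (D ⧸ P) V ≤ (Fintype.card G * r : ℕ) := by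
    refine rank_le fun s hs ↦ ?_
    obtain ⟨S, hSr, hS⟩ := hr
      (Submodule.span (MonoidAlgebra D G) (s.image Subtype.val : Finset A)) ⟨_, rfl⟩
    have hSV : ∀ a ∈ S, a ∈ V := by
      have hle : ∀ a ∈ Submodule.span (MonoidAlgebra D G) (s.image Subtype.val : Finset A),
          a ∈ V := by
        intro a ha
        induction ha using Submodule.span_induction with
        | mem a h =>
          obtain ⟨b, _, rfl⟩ := Finset.mem_image.1 (Finset.mem_coe.1 h)
          exact b.2
        | zero => exact zero_mem _
        | add a b _ _ ha hb => exact add_mem ha hb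
        | smul x a _ ha => exact hVG x a ha
      intro a ha
      exact hle a (hS ▸ Submodule.subset_span ha)
    let w : G × S → V := fun p ↦ ⟨MonoidAlgebra.of D G p.1 • (p.2 : A), hVG _ _ (hSV _ p.2.2)⟩
    have hspanG : Submodule.span D (Set.range (MonoidAlgebra.of D G)) = ⊤ := by
      refine eq_top_iff.2 fun f _ ↦ ?_
      exact Submodule.span_mono (Set.image_subset_range _ _)
        (MonoidAlgebra.mem_span_support_coeff f)
    have hsw : ∀ v ∈ s, v ∈ Submodule.span (D ⧸ P) (Set.range w) := by
      intro v hv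
      have h1 : (v : A) ∈ (Submodule.span (MonoidAlgebra D G) (S : Set A)).restrictScalars D := by
        rw [hS]
        exact Submodule.subset_span (Finset.mem_coe.2 (Finset.mem_image_of_mem _ hv))
      rw [← Submodule.span_smul_of_span_eq_top hspanG] at h1
      have h2 : Submodule.span D (Set.range (MonoidAlgebra.of D G) • (S : Set A)) ≤
          (Submodule.span D (Set.range w)).map V.subtype := by
        rw [Submodule.map_span, Submodule.span_le]
        rintro _ ⟨_, ⟨g, rfl⟩, a, ha, rfl⟩
        exact Submodule.subset_span ⟨w (g, ⟨a, ha⟩), ⟨_, rfl⟩, rfl⟩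
      obtain ⟨u, hu, huv⟩ := h2 h1
      obtain rfl : u = v := Subtype.ext huv
      exact Submodule.span_le_restrictScalars D (D ⧸ P) _ hu
    have hcard := linearIndependent_le_span_aux' _ hs (Set.range w) (by
      rintro _ ⟨i, rfl⟩
      exact hsw _ i.2)
    rw [Fintype.card_coe] at hcard
    calc s.card ≤ Fintype.card (Set.range w) := hcard
      _ ≤ Fintype.card (G × S) :=
        Fintype.card_le_of_surjective _ Set.rangeFactorization_surjective
      _ ≤ Fintype.card G * r := by
        rw [Fintype.card_prod, Fintype.card_coe]
        exact Nat.mul_le_mul_left _ hSr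
  have : Module.Finite (D ⧸ P) V :=
    Module.rank_lt_aleph0_iff.1 (hrank.trans_lt (Cardinal.natCast_lt_aleph0))
  rw [← Module.Finite.iff_fg]
  have : Module.Finite D (D ⧸ P) := inferInstance
  exact Module.Finite.trans (D ⧸ P) V

theorem exists_isCompl_of_restrictScalars_isCompl (B : Submodule (MonoidAlgebra D G) A)
    (hcard : ∀ b ∈ B, ∃! c, c ∈ B ∧ (Nat.card G : D) • c = b)
    (h : ∃ K, IsCompl (B.restrictScalars D) K) :
    ∃ K, IsCompl K B := by
  have := Fintype.ofFinite G
  obtain ⟨K, hK⟩ := h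
  let p : A →ₗ[D] B := Submodule.projectionOnto (B.restrictScalars D) K hK
  have hp : ∀ b : B, p b = b := Submodule.projectionOnto_apply_left hK
  let f : A →ₗ[MonoidAlgebra D G] B := p.sumOfConjugatesEquivariant G
  have hf : ∀ b : B, f b = (Nat.card G : D) • b := by
    intro b
    have h1 := LinearMap.sumOfConjugatesEquivariant_apply (G := G) p (b : A)
    have h2 := fun g ↦ LinearMap.conjugate_i p B.subtype hp g b
    simp only [Submodule.subtype_apply] at h2
    simp only [h2, Finset.sum_const, Finset.card_univ, Fintype.card_eq_nat_card] at h1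
    rw [Nat.cast_smul_eq_nsmul]
    exact h1
  refine ⟨LinearMap.ker f, ?_, ?_⟩
  · rw [Submodule.disjoint_def]
    intro b hb hbB
    rw [LinearMap.mem_ker] at hb
    have h1 : (Nat.card G : D) • b = 0 := by
      rw [hf ⟨b, hbB⟩] at hb
      exact congrArg Subtype.val hb
    exact (hcard 0 (zero_mem _)).unique ⟨hbB, h1⟩ ⟨zero_mem _, smul_zero _⟩
  · rw [codisjoint_iff, eq_top_iff]
    intro a _
    obtain ⟨c, ⟨hcB, hc⟩, -⟩ := hcard (f a) (f a).2
    rw [← sub_add_cancel a c]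
    refine Submodule.add_mem_sup ?_ hcB
    rw [LinearMap.mem_ker, map_sub, hf ⟨c, hcB⟩, sub_eq_zero]
    exact Subtype.ext hc.symm

end MonoidAlgebraModules

/-- Let `D` be a Dedekind domain, `G` a finite group, `P` a maximal ideal with
`char(D/P) = 0`, and `A` a `DG`-module which is a `P`-module of finite special rank. Then
`A = K ⊕ B` as `DG`-modules, where `K` is finitely generated as a `D`-module and `B` is a
direct sum of finitely many Prüfer `P`-modules. -/
theorem stmt16 (D : Type*) [CommRing D] [IsDedekindDomain D]
    (G : Type*) [Group G] [Finite G]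
    (P : Ideal D) [P.IsMaximal] [CharZero (D ⧸ P)]
    (A : Type*) [AddCommGroup A] [Module (MonoidAlgebra D G) A]
    [Module D A] [IsScalarTower D (MonoidAlgebra D G) A]
    (hP : ∀ a : A, ∃ n : ℕ, ∀ x ∈ P ^ n, x • a = 0)
    (hsr : ∃ r : ℕ, ∀ N : Submodule (MonoidAlgebra D G) A, N.FG →
      ∃ S : Finset A, S.card ≤ r ∧ Submodule.span (MonoidAlgebra D G) (S : Set A) = N) :
    ∃ K B : Submodule (MonoidAlgebra D G) A, IsCompl K B ∧
      (K.restrictScalars D).FG ∧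
      ∃ (m : ℕ) (Cf : Fin m → Submodule D A), iSupIndep Cf ∧
        (⨆ i, Cf i) = B.restrictScalars D ∧
        ∀ i, IsPruferPModule D P ↥(Cf i) := by
  have : SMulCommClass D (MonoidAlgebra D G) A := IsScalarTower.to_smulCommClass
  obtain ⟨r, hr⟩ := hsr
  have hfg := torsionBySet_fg_of_finite_special_rank P hr
  by_cases hP0 : P = ⊥
  · refine ⟨⊤, ⊥, isCompl_top_bot, ?_, 0, fun _ ↦ ⊥, fun i ↦ i.elim0, by simp, fun i ↦ i.elim0⟩
    convert hfg
    rw [hP0]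
    ext a
    simp
  obtain ⟨π, hπ, hπ'⟩ := exists_uniformizer hP0
  rw [torsionBySet_eq_torsionBy hP hπ hπ'] at hfg
  obtain ⟨N, hN⟩ := exists_pow_smul_eq_pow_smul hP hπ hπ' hfg
  let B : Submodule (MonoidAlgebra D G) A :=
    LinearMap.range (π ^ N • (LinearMap.id : A →ₗ[MonoidAlgebra D G] A))
  have hmem : ∀ a : A, π ^ N • a ∈ B := fun a ↦ ⟨a, rfl⟩
  have hsmul : ∀ (d : D), ∀ b ∈ B, d • b ∈ B := fun d b hb ↦
    (B.restrictScalars D).smul_mem d hb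
  have hdiv : ∀ b ∈ B.restrictScalars D, ∃ c ∈ B.restrictScalars D, π • c = b := by
    rintro _ ⟨a, rfl⟩
    obtain ⟨c, hc⟩ := hN a (N + 1) (Nat.le_succ N)
    refine ⟨π ^ N • c, hmem c, ?_⟩
    rw [smul_smul, ← pow_succ', ← hc]
    rfl
  have hcard : (Nat.card G : D) ∉ P := by
    rw [← Ideal.Quotient.eq_zero_iff_mem, map_natCast]
    exact Nat.cast_ne_zero.2 Nat.card_pos.ne'
  obtain ⟨K, hK⟩ := exists_isCompl_of_restrictScalars_isCompl B (fun b hb ↦ by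
    obtain ⟨y, hy⟩ := exists_smul_smul_eq hP hcard b
    refine ⟨y • b, ⟨hsmul y b hb, by rw [smul_comm, hy]⟩, ?_⟩
    rintro c ⟨hc, rfl⟩
    obtain ⟨z, hz⟩ := exists_smul_smul_eq hP hcard c
    rw [← hz, smul_comm _ z, smul_comm _ z, hy])
    (exists_isCompl_of_divisible hP hπ hπ' _ hdiv)
  refine ⟨K, B, hK, ?_, exists_pruferPModule_decomposition hP hπ hπ' hfg _ hdiv⟩
  refine (torsionBy_pow_fg hfg N).of_le fun k hk ↦ ?_
  rw [Submodule.mem_torsionBy_iff]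
  exact Submodule.disjoint_def.1 hK.disjoint _ ((K.restrictScalars D).smul_mem _ hk) (hmem k)
end
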